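/- Let a, b ∈ (0,1) with a + b > 1, let c ∈ ℝ, and let α ∈ (0,1). Then lim_{n→∞} n^{3/2} · Q_n(⌊an − c·n^α⌋, ⌊bn − c·n^α⌋) / C_n = 1 / (2√π · (2−a−b)^{3/2} · (a+b−1)^{3/2}). -/

import Mathlib

open Filter Finset Real

/-- `σ` contains the pattern `τ`. -/
def ContainsPattern {n m : ℕ} (σ : Equiv.Perm (Fin n)) (τ : Equiv.Perm (Fin m)) : Prop :=
  ∃ f : Fin m → Fin n, StrictMono f ∧ ∀ a b : Fin m, σ (f a) < σ (f b) ↔ τ a < τ b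

/-- `σ` avoids the pattern `τ`. -/
def Avoids {n m : ℕ} (σ : Equiv.Perm (Fin n)) (τ : Equiv.Perm (Fin m)) : Prop :=
  ¬ ContainsPattern σ τ

/-- The pattern (1,2,3) ∈ S₃ (0-indexed: 0,1,2). -/
def pattern123 : Equiv.Perm (Fin 3) := 1

/-- The pattern (1,3,2) ∈ S₃ (0-indexed: 0,2,1). -/
def pattern132 : Equiv.Perm (Fin 3) := Equiv.swap 1 2

/-- The pattern (3,2,1) ∈ S₃ (0-indexed: 2,1,0). -/
def pattern321 : Equiv.Perm (Fin 3) := Equiv.swap 0 2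

/-- The pattern (2,3,1) ∈ S₃ (0-indexed: 1,2,0). -/
def pattern231 : Equiv.Perm (Fin 3) := (Equiv.swap 1 2).trans (Equiv.swap 0 1)

/-- `Q_n(j,k)` with integer arguments: the number of 132-avoiding permutations of
`{1,…,n}` with value `k` in position `j` (1-indexed); `0` when `j` or `k` is out of
range. -/
noncomputable def QcountZ (n : ℕ) (j k : ℤ) : ℕ :=
  Nat.card {σ : Equiv.Perm (Fin n) //
    Avoids σ pattern132 ∧ ∃ i : Fin n, ((i : ℕ) : ℤ) + 1 = j ∧ ((σ i : ℕ) : ℤ) + 1 = k}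

/-- The forbidden-triple predicate on values. -/
def P132 (a b c : ℕ) : Prop := ¬ (a < c ∧ c < b)

/-- The word of the 132-avoider coded by a binary tree. -/
def toL : BinaryTree Unit → List ℕ
  | .nil => []
  | .node _ l r => (toL l).map (· + r.numNodes) ++ (l.numNodes + r.numNodes) :: toL r

/-- Lists which are the words of 132-avoiders (0-indexed). -/
def GoodL (n : ℕ) (l : List ℕ) : Prop :=
  l.Nodup ∧ l.length = n ∧ (∀ x ∈ l, x < n) ∧ l.Triplewise P132

theorem toL_length (t : BinaryTree Unit) : (toL t).length = t.numNodes := by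
  induction t with
  | nil => simp [toL]
  | node _ l r hl hr => simp [toL, hl, hr]; omega

theorem toL_lt (t : BinaryTree Unit) : ∀ x ∈ toL t, x < t.numNodes := by
  induction t with
  | nil => simp [toL]
  | node _ l r hl hr =>
    intro x hx
    simp only [toL, List.mem_append, List.mem_map, List.mem_cons] at hx
    simp only [BinaryTree.numNodes]
    rcases hx with ⟨y, hy, rfl⟩ | rfl | hx
    · have := hl y hy; omega
    · omega
    · have := hr x hx; omega

theorem toL_good (t : BinaryTree Unit) : GoodL t.numNodes (toL t) := by
  refine ⟨?_, toL_length t, toL_lt t, ?_⟩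
  · induction t with
    | nil => simp [toL]
    | node _ l r hl hr =>
      simp only [toL, List.nodup_append, List.nodup_cons, List.mem_map, List.mem_cons]
      refine ⟨hl.map (fun a b h => by simpa using h), ⟨fun h => ?_, hr⟩, ?_⟩
      · have := toL_lt r _ h; omega
      · rintro _ ⟨y, hy, rfl⟩ z (rfl | hz)
        · have := toL_lt l _ hy; omega
        · have := toL_lt r _ hz; omega
  · induction t with
    | nil => simp [toL]
    | node _ l r hl hr =>
      simp only [toL, List.triplewise_append, List.triplewise_cons, List.pairwise_cons]
      have hL : ∀ x ∈ (toL l).map (· + r.numNodes),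
          r.numNodes ≤ x ∧ x < l.numNodes + r.numNodes := by
        intro x hx
        simp only [List.mem_map] at hx
        obtain ⟨y, hy, rfl⟩ := hx
        have := toL_lt l _ hy
        omega
      have hR := toL_lt r
      refine ⟨?_, ⟨?_, hr⟩, ?_, ?_⟩
      · apply hl.map
        intro a b c h
        unfold P132 at *
        omega
      · rw [List.pairwise_iff_forall_sublist]
        intro a b hab
        have ha := hR a (hab.subset (by simp))
        have hb := hR b (hab.subset (by simp))
        unfold P132
        omega
      · intro a ha
        have ha' := hL a ha
        refine ⟨?_, ?_⟩
        · intro b hb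
          have hb' := hR b hb
          unfold P132; omega
        · rw [List.pairwise_iff_forall_sublist]
          intro x y hab
          have hy := hR y (hab.subset (by simp))
          unfold P132
          omega
      · intro c hc
        rw [List.pairwise_iff_forall_sublist]
        intro x y hab
        have hx := hL x (hab.subset (by simp))
        have hy := hL y (hab.subset (by simp))
        simp only [List.mem_cons] at hc
        rcases hc with rfl | hc
        · unfold P132; omega
        · have := hR c hc
          unfold P132; omega

theorem goodL_mem {n : ℕ} {l : List ℕ} (h : GoodL n l) {x : ℕ} (hx : x < n) : x ∈ l := by
  obtain ⟨h1, h2, h3, -⟩ := h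
  have hs : l.toFinset ⊆ Finset.range n := by
    intro y hy
    simpa using h3 y (by simpa using hy)
  have := Finset.eq_of_subset_of_card_le hs (by
    rw [List.toFinset_card_of_nodup h1, h2, Finset.card_range])
  have hx' : x ∈ l.toFinset := by rw [this]; simpa using hx
  simpa using hx'

theorem toL_surj : ∀ (n : ℕ) (l : List ℕ), GoodL n l → ∃ t : BinaryTree Unit,
    t.numNodes = n ∧ toL t = l := by
  intro n
  induction n using Nat.strong_induction_on with
  | _ n ih =>
  intro l hl
  rcases n with _ | n
  · refine ⟨.nil, rfl, ?_⟩
    have := hl.2.1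
    simp [List.length_eq_zero_iff] at this
    simp [toL, this]
  · obtain ⟨l1, l2, rfl⟩ := List.append_of_mem (goodL_mem hl (Nat.lt_succ_self n))
    have hmem := @goodL_mem _ _ hl
    obtain ⟨h1, h2, h3, h4⟩ := hl
    simp only [List.nodup_append, List.nodup_cons, List.mem_cons] at h1
    simp only [List.triplewise_append, List.triplewise_cons, List.pairwise_cons] at h4
    simp only [List.length_append, List.length_cons] at h2
    obtain ⟨n1, ⟨n2, n3⟩, n4⟩ := h1
    obtain ⟨t1, ⟨t2, t3⟩, t4, t5⟩ := h4
    have hlt1 : ∀ x ∈ l1, x < n := by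
      intro x hx
      have a1 := h3 x (by simp [hx])
      have a2 := n4 x hx n (by simp)
      omega
    have hlt2 : ∀ x ∈ l2, x < n := by
      intro x hx
      have a1 := h3 x (by simp [hx])
      have a2 : x ≠ n := by rintro rfl; exact n2 hx
      omega
    have hgt : ∀ x ∈ l1, ∀ y ∈ l2, y < x := by
      intro x hx y hy
      have a1 := (t4 x hx).1 y hy
      have a2 := n4 x hx y (by simp [hy])
      have := hlt2 y hy
      unfold P132 at a1
      omega
    have hb2 : ∀ y ∈ l2, y < l2.length := by
      intro y hy
      have hs : Finset.range (y+1) ⊆ l2.toFinset := by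
        intro z hz
        simp only [Finset.mem_range] at hz
        have := hlt2 y hy
        have hz' := hmem (x := z) (by omega)
        simp only [List.mem_append, List.mem_cons] at hz'
        rcases hz' with hz' | hz' | hz'
        · have := hgt z hz' y hy; omega
        · omega
        · simpa using hz'
      have := Finset.card_le_card hs
      rw [List.toFinset_card_of_nodup n3, Finset.card_range] at this
      omega
    have hb1 : ∀ x ∈ l1, l2.length ≤ x := by
      intro x hx
      have hs : l2.toFinset ⊆ Finset.range x := by
        intro z hz
        simp only [List.mem_toFinset] at hz
        simpa using hgt x hx z hz
      have := Finset.card_le_card hs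
      rwa [List.toFinset_card_of_nodup n3, Finset.card_range] at this
    have g2 : GoodL l2.length l2 := ⟨n3, rfl, hb2, t3⟩
    have e1 : (l1.map (· - l2.length)).map (· + l2.length) = l1 := by
      rw [List.map_map]
      conv_rhs => rw [← List.map_id l1]
      apply List.map_congr_left
      intro x hx
      have := hb1 x hx
      simp; omega
    have g1 : GoodL l1.length (l1.map (· - l2.length)) := by
      refine ⟨?_, by simp, ?_, ?_⟩
      · apply List.Nodup.of_map (· + l2.length)
        rw [e1]; exact n1
      · intro x hx
        simp only [List.mem_map] at hx
        obtain ⟨y, hy, rfl⟩ := hx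
        have := hb1 y hy
        have := hlt1 y hy
        omega
      · rw [← e1] at t1
        apply List.Triplewise.of_map _ t1
        intro a b c h
        unfold P132 at *
        omega
    obtain ⟨r, hr, hr'⟩ := ih l2.length (by omega) l2 g2
    obtain ⟨q, hq, hq'⟩ := ih l1.length (by omega) _ g1
    refine ⟨.node () q r, ?_, ?_⟩
    · simp [hq, hr]; omega
    · simp only [toL, hq', hr, hq, hr', e1]
      congr 2
      omega

theorem toL_inj : ∀ (s t : BinaryTree Unit), toL s = toL t → s = t := by
  intro s
  induction s with
  | nil =>
    intro t h
    cases t with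
    | nil => rfl
    | node _ l r => simp [toL] at h
  | node _ l r hl hr =>
    intro t h
    cases t with
    | nil => simp [toL] at h
    | node _ l' r' =>
      have hlen : (BinaryTree.node () l r).numNodes = (BinaryTree.node () l' r').numNodes := by
        rw [← toL_length, ← toL_length]; exact congrArg _ h
      simp only [BinaryTree.numNodes] at hlen
      have hlen' : l.numNodes + r.numNodes = l'.numNodes + r'.numNodes := by omega
      simp only [toL] at h
      rw [hlen'] at h
      have k1 : (l'.numNodes + r'.numNodes) ∉ (toL l).map (· + r.numNodes) := by
        intro hx
        simp only [List.mem_map] at hx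
        obtain ⟨y, hy, e⟩ := hx
        have := toL_lt l y hy
        omega
      have k2 : (l'.numNodes + r'.numNodes) ∉ (toL l').map (· + r'.numNodes) := by
        intro hx
        simp only [List.mem_map] at hx
        obtain ⟨y, hy, e⟩ := hx
        have := toL_lt l' y hy
        omega
      have k3 : (l'.numNodes + r'.numNodes) ∉ toL r := by
        intro hx
        have := toL_lt r _ hx
        omega
      have k4 : (l'.numNodes + r'.numNodes) ∉ toL r' := by
        intro hx
        have := toL_lt r' _ hx
        omega
      have hr1 : (toL l).map (· + r.numNodes) = (toL l').map (· + r'.numNodes) ∧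
          toL r = toL r' := by
        have hi : ((toL l).map (· + r.numNodes)).length =
            ((toL l').map (· + r'.numNodes)).length := by
          have := congrArg (List.idxOf (l'.numNodes + r'.numNodes)) h
          rw [List.idxOf_append_of_notMem k1, List.idxOf_append_of_notMem k2] at this
          simpa using this
        have := List.append_inj h hi
        simpa using this
      obtain ⟨e1, e2⟩ := hr1
      have er := hr r' e2
      subst er
      have : toL l = toL l' := List.map_injective_iff.2 (fun a b h => by simpa using h) e1
      rw [hl l' this]

/-- Indicator that the tree `t` has a node with `u` larger values and `v` later positions. -/
noncomputable def hit : BinaryTree Unit → ℤ → ℤ → ℕ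
  | .nil, _, _ => 0
  | .node _ l r, u, v => hit l (u - 1) (v - r.numNodes - 1) +
      (if u = 0 ∧ v = r.numNodes then 1 else 0) + hit r (u - l.numNodes - 1) v

theorem hit_range (t : BinaryTree Unit) : ∀ u v : ℤ, hit t u v ≠ 0 →
    0 ≤ u ∧ u < t.numNodes ∧ 0 ≤ v ∧ v < t.numNodes := by
  induction t with
  | nil => intro u v h; simp [hit] at h
  | node _ l r hl hr =>
    intro u v h
    simp only [BinaryTree.numNodes]
    push_cast
    by_cases h1 : hit l (u - 1) (v - r.numNodes - 1) = 0
    · by_cases h2 : hit r (u - l.numNodes - 1) v = 0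
      · simp only [hit, h1, h2] at h
        by_cases h3 : u = 0 ∧ v = r.numNodes
        · omega
        · simp [h3] at h
      · have := hr _ _ h2; omega
    · have := hl _ _ h1; omega

open Classical in
theorem hit_eq (t : BinaryTree Unit) : ∀ u v : ℤ, hit t u v =
    if (∃ i x : ℕ, (toL t)[i]? = some x ∧ (x : ℤ) = t.numNodes - 1 - u ∧
      (i : ℤ) = t.numNodes - 1 - v) then 1 else 0 := by
  induction t with
  | nil => intro u v; simp [hit, toL]
  | node _ l r hl hr =>
    intro u v
    have key : (∃ i x : ℕ, (toL (.node () l r))[i]? = some x ∧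
        (x : ℤ) = (BinaryTree.node () l r).numNodes - 1 - u ∧
        (i : ℤ) = (BinaryTree.node () l r).numNodes - 1 - v) ↔
        (∃ i x : ℕ, (toL l)[i]? = some x ∧ (x : ℤ) = l.numNodes - 1 - (u - 1) ∧
          (i : ℤ) = l.numNodes - 1 - (v - r.numNodes - 1)) ∨ (u = 0 ∧ v = r.numNodes) ∨
        (∃ i x : ℕ, (toL r)[i]? = some x ∧ (x : ℤ) = r.numNodes - 1 - (u - l.numNodes - 1) ∧
          (i : ℤ) = r.numNodes - 1 - v) := by
      simp only [toL, BinaryTree.numNodes]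
      constructor
      · rintro ⟨i, x, h1, h2, h3⟩
        push_cast at h2 h3
        rcases lt_trichotomy i l.numNodes with h | h | h
        · left
          rw [List.getElem?_append_left (by simpa [toL_length] using h), List.getElem?_map] at h1
          simp only [Option.map_eq_some_iff] at h1
          obtain ⟨y, hy, rfl⟩ := h1
          refine ⟨i, y, hy, ?_, ?_⟩
          · push_cast at h2; omega
          · omega
        · right; left
          rw [List.getElem?_append_right (by simp [toL_length, h])] at h1
          simp [toL_length, h] at h1
          omega
        · right; right
          rw [List.getElem?_append_right (by simpa [toL_length] using h.le)] at h1
          obtain ⟨d, rfl⟩ : ∃ d, i = l.numNodes + d + 1 := ⟨i - l.numNodes - 1, by omega⟩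
          simp only [List.length_map, toL_length] at h1
          rw [show l.numNodes + d + 1 - l.numNodes = d + 1 by omega] at h1
          simp only [List.getElem?_cons_succ] at h1
          refine ⟨d, x, h1, ?_, ?_⟩
          · omega
          · push_cast at h3; omega
      · rintro (⟨i, x, h1, h2, h3⟩ | ⟨h1, h2⟩ | ⟨i, x, h1, h2, h3⟩)
        · have hi : i < l.numNodes := by
            have := (List.getElem?_eq_some_iff.1 h1).1
            rwa [toL_length] at this
          refine ⟨i, x + r.numNodes, ?_, ?_, ?_⟩
          · rw [List.getElem?_append_left (by simpa [toL_length] using hi), List.getElem?_map, h1]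
            simp
          · push_cast; omega
          · push_cast; omega
        · refine ⟨l.numNodes, l.numNodes + r.numNodes, ?_, ?_, ?_⟩
          · rw [List.getElem?_append_right (by simp [toL_length])]
            simp [toL_length]
          · push_cast; omega
          · push_cast; omega
        · refine ⟨l.numNodes + i + 1, x, ?_, ?_, ?_⟩
          · rw [List.getElem?_append_right (by simp [toL_length]; omega)]
            simp only [List.length_map, toL_length]
            rw [show l.numNodes + i + 1 - l.numNodes = i + 1 by omega]
            simpa using h1
          · push_cast; omega
          · push_cast; omega
    have r1 := hit_range l (u - 1) (v - r.numNodes - 1)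
    have r2 := hit_range r (u - l.numNodes - 1) v
    rw [if_congr key rfl rfl]
    simp only [hit]
    rw [hl] at r1 ⊢
    rw [hr] at r2 ⊢
    clear hl hr key
    generalize (∃ i x : ℕ, (toL l)[i]? = some x ∧ (x : ℤ) = l.numNodes - 1 - (u - 1) ∧
          (i : ℤ) = l.numNodes - 1 - (v - r.numNodes - 1)) = A at r1 ⊢
    generalize (∃ i x : ℕ, (toL r)[i]? = some x ∧
          (x : ℤ) = r.numNodes - 1 - (u - l.numNodes - 1) ∧
          (i : ℤ) = r.numNodes - 1 - v) = B at r2 ⊢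
    by_cases hA : A <;> by_cases hB : B <;> by_cases hC : (u = 0 ∧ v = r.numNodes) <;>
      simp only [hA, hB, hC] at r1 r2 ⊢ <;> simp at r1 r2 ⊢ <;> omega

theorem avoids_iff {n : ℕ} (σ : Equiv.Perm (Fin n)) :
    Avoids σ pattern132 ↔ (List.ofFn (fun i => (σ i : ℕ))).Triplewise P132 := by
  rw [List.triplewise_iff_getElem]
  unfold Avoids ContainsPattern
  constructor
  · intro h i j k hij hjk hk
    simp only [List.length_ofFn] at hk
    simp only [List.getElem_ofFn]
    intro ⟨h1, h2⟩
    apply h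
    refine ⟨![⟨i, by omega⟩, ⟨j, by omega⟩, ⟨k, hk⟩], ?_, ?_⟩
    · intro a b hab
      fin_cases a <;> fin_cases b <;> simp_all <;> omega
    · intro a b
      have h1' : σ ⟨i, by omega⟩ < σ ⟨k, hk⟩ := h1
      have h2' : σ ⟨k, hk⟩ < σ ⟨j, by omega⟩ := h2
      have e0 : pattern132 0 = 0 := by decide
      have e1 : pattern132 1 = 2 := by decide
      have e2 : pattern132 2 = 1 := by decide
      fin_cases a <;> fin_cases b <;> simp [e0, e1, e2] <;> omega
  · intro h ⟨f, hf, hp⟩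
    have h01 : f 0 < f 1 := hf (by decide)
    have h12 : f 1 < f 2 := hf (by decide)
    have := h (f 0) (f 1) (f 2) h01 h12 (by simp)
    simp only [List.getElem_ofFn, P132] at this
    apply this
    exact ⟨(hp 0 2).2 (by decide), (hp 2 1).2 (by decide)⟩

theorem ofFn_good {n : ℕ} (σ : Equiv.Perm (Fin n)) (h : Avoids σ pattern132) :
    GoodL n (List.ofFn (fun i => (σ i : ℕ))) := by
  refine ⟨?_, by simp, ?_, (avoids_iff σ).1 h⟩
  · rw [List.nodup_ofFn]
    intro a b hab
    exact σ.injective (Fin.ext hab)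
  · intro x hx
    rw [List.mem_ofFn] at hx
    obtain ⟨i, rfl⟩ := hx
    exact (σ i).2

theorem good_ofFn {n : ℕ} {l : List ℕ} (h : GoodL n l) :
    ∃ σ : Equiv.Perm (Fin n), l = List.ofFn (fun i => (σ i : ℕ)) ∧ Avoids σ pattern132 := by
  obtain ⟨h1, h2, h3, h4⟩ := h
  subst h2
  let f : Fin l.length → Fin l.length := fun i => ⟨l[i], h3 _ (by simp)⟩
  have hf : Function.Injective f := by
    intro a b hab
    simp only [f, Fin.mk.injEq] at hab
    exact Fin.ext ((List.Nodup.getElem_inj_iff h1).1 hab)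
  let σ : Equiv.Perm (Fin l.length) := Equiv.ofBijective f (Finite.injective_iff_bijective.1 hf)
  have e : l = List.ofFn (fun i => (σ i : ℕ)) := by
    apply List.ext_getElem
    · simp
    · intro i hi hi'
      simp [σ, f]
  refine ⟨σ, e, ?_⟩
  rw [avoids_iff, ← e]
  exact h4

open Classical in
theorem QcountZ_eq (n : ℕ) (j k : ℤ) :
    QcountZ n j k = ∑ t ∈ BinaryTree.treesOfNumNodesEq n, hit t (n - k) (n - j) := by
  have hs : ∑ t ∈ BinaryTree.treesOfNumNodesEq n, hit t (n - k) (n - j) =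
      ((BinaryTree.treesOfNumNodesEq n).filter (fun t => ∃ i x : ℕ, (toL t)[i]? = some x ∧
        (x : ℤ) = n - 1 - (n - k) ∧ (i : ℤ) = n - 1 - (n - j))).card := by
    rw [Finset.card_filter]
    apply Finset.sum_congr rfl
    intro t ht
    rw [BinaryTree.mem_treesOfNumNodesEq] at ht
    rw [hit_eq, ht]
  rw [hs, QcountZ, Nat.card_eq_fintype_card, Fintype.card_subtype]
  have hpos : ∀ (σ : Equiv.Perm (Fin n)) (t : BinaryTree Unit),
      toL t = List.ofFn (fun i => (σ i : ℕ)) →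
      ((∃ i : Fin n, ((i : ℕ) : ℤ) + 1 = j ∧ ((σ i : ℕ) : ℤ) + 1 = k) ↔
      ∃ i x : ℕ, (toL t)[i]? = some x ∧
        (x : ℤ) = n - 1 - (n - k) ∧ (i : ℤ) = n - 1 - (n - j)) := by
    intro σ t h
    rw [h]
    constructor
    · rintro ⟨i, h1, h2⟩
      refine ⟨i, σ i, by simp, by omega, by omega⟩
    · rintro ⟨i, x, h1, h2, h3⟩
      rw [List.getElem?_eq_some_iff] at h1
      obtain ⟨hi, hx⟩ := h1
      simp only [List.length_ofFn] at hi
      simp only [List.getElem_ofFn] at hx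
      exact ⟨⟨i, hi⟩, by simp; omega, by rw [hx]; omega⟩
  have hex : ∀ σ : Equiv.Perm (Fin n), ∃ t : BinaryTree Unit, Avoids σ pattern132 →
      t.numNodes = n ∧ toL t = List.ofFn (fun i => (σ i : ℕ)) := by
    intro σ
    by_cases h : Avoids σ pattern132
    · obtain ⟨t, ht⟩ := toL_surj n _ (ofFn_good σ h)
      exact ⟨t, fun _ => ht⟩
    · exact ⟨.nil, fun h' => absurd h' h⟩
  choose g hg using hex
  apply Finset.card_bij (fun σ _ => g σ)
  · intro σ hσ
    simp only [Finset.mem_filter, Finset.mem_univ, true_and] at hσ ⊢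
    rw [BinaryTree.mem_treesOfNumNodesEq]
    obtain ⟨e1, e2⟩ := hg σ hσ.1
    exact ⟨e1, (hpos σ _ e2).1 hσ.2⟩
  · intro σ hσ τ hτ h
    simp only [Finset.mem_filter, Finset.mem_univ, true_and] at hσ hτ
    have e := (hg σ hσ.1).2
    rw [h, (hg τ hτ.1).2, List.ofFn_inj] at e
    ext i
    exact (congrFun e i).symm
  · intro t ht
    simp only [Finset.mem_filter, BinaryTree.mem_treesOfNumNodesEq] at ht
    obtain ⟨h1, h2⟩ := ht
    have hgood := toL_good t
    rw [h1] at hgood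
    obtain ⟨σ, e, hσ⟩ := good_ofFn hgood
    refine ⟨σ, ?_, ?_⟩
    · simp only [Finset.mem_filter, Finset.mem_univ, true_and]
      exact ⟨hσ, (hpos σ t e).2 h2⟩
    · apply toL_inj
      rw [(hg σ hσ).2, e]

/-- Ballot numbers, as coefficients of `X^r C^(r+1)`. -/
noncomputable def Bn (r u : ℕ) : ℕ :=
  PowerSeries.coeff u (PowerSeries.X ^ r * PowerSeries.catalanSeries ^ (r + 1))

/-- Ballot numbers extended by zero to the integers. -/
noncomputable def Bz (r : ℕ) (u : ℤ) : ℕ := if 0 ≤ u then Bn r u.toNat else 0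

/-- Catalan numbers extended by zero to the integers. -/
def cz (m : ℤ) : ℕ := if 0 ≤ m then catalan m.toNat else 0

theorem Bn_zero (u : ℕ) : Bn 0 u = catalan u := by simp [Bn]

theorem Bn_lt {r u : ℕ} (h : u < r) : Bn r u = 0 := by
  unfold Bn
  rw [PowerSeries.coeff_X_pow_mul']
  simp [h]

theorem Bn_succ_zero (r : ℕ) : Bn (r + 1) 0 = 0 := Bn_lt (by omega)

theorem Bn_conv (r u : ℕ) : Bn (r + 1) (u + 1) =
    ∑ p ∈ Finset.HasAntidiagonal.antidiagonal u, catalan p.1 * Bn r p.2 := by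
  unfold Bn
  rw [show (PowerSeries.X : PowerSeries ℕ) ^ (r + 1) * PowerSeries.catalanSeries ^ (r + 1 + 1) =
    (PowerSeries.catalanSeries * (PowerSeries.X ^ r * PowerSeries.catalanSeries ^ (r + 1))) *
      PowerSeries.X by ring, PowerSeries.coeff_succ_mul_X, PowerSeries.coeff_mul]
  simp

theorem Bn_rec (r u : ℕ) : Bn (r + 1) (u + 1) = Bn r u + Bn (r + 2) (u + 1) := by
  unfold Bn
  have : (PowerSeries.X : PowerSeries ℕ) ^ (r + 1) * PowerSeries.catalanSeries ^ (r + 1 + 1) =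
    (PowerSeries.X ^ r * PowerSeries.catalanSeries ^ (r + 1)) * PowerSeries.X +
      PowerSeries.X ^ (r + 2) * PowerSeries.catalanSeries ^ (r + 2 + 1) := by
    calc (PowerSeries.X : PowerSeries ℕ) ^ (r + 1) * PowerSeries.catalanSeries ^ (r + 1 + 1) =
      PowerSeries.X ^ (r + 1) * PowerSeries.catalanSeries ^ (r + 1) *
        PowerSeries.catalanSeries := by ring
      _ = PowerSeries.X ^ (r + 1) * PowerSeries.catalanSeries ^ (r + 1) *
        (PowerSeries.catalanSeries ^ 2 * PowerSeries.X + 1) := by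
          rw [PowerSeries.catalanSeries_sq_mul_X_add_one]
      _ = _ := by ring
  rw [this, map_add, PowerSeries.coeff_succ_mul_X]

theorem Bn_rec_zero (u : ℕ) : Bn 0 (u + 1) = Bn 1 (u + 1) := by
  rw [Bn_conv, Bn_zero, catalan_succ']
  simp [Bn_zero]

theorem Bz_neg {r : ℕ} {u : ℤ} (h : u < 0) : Bz r u = 0 := by
  simp [Bz, h]

theorem Bz_lt {r : ℕ} {u : ℤ} (h : u < r) : Bz r u = 0 := by
  unfold Bz
  split_ifs with h0
  · apply Bn_lt; omega
  · rfl

theorem Bz_rec (r : ℕ) (u : ℤ) : Bz (r + 1) u = Bz r (u - 1) + Bz (r + 2) u := by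
  rcases lt_trichotomy u 0 with h | h | h
  · rw [Bz_neg h, Bz_neg h, Bz_neg (by omega)]
  · rw [Bz_lt (by omega), Bz_lt (by omega), Bz_lt (by omega)]
  · obtain ⟨w, rfl⟩ : ∃ w : ℕ, u = w + 1 := ⟨(u - 1).toNat, by omega⟩
    have e1 : ((w : ℤ) + 1).toNat = w + 1 := by omega
    have e2 : (0 : ℤ) ≤ (w : ℤ) + 1 := by omega
    have e3 : (0 : ℤ) ≤ (w : ℤ) + 1 - 1 := by omega
    have e4 : ((w : ℤ) + 1 - 1).toNat = w := by omega
    rw [Bz, Bz, Bz, if_pos e2, if_pos e2, if_pos e3, e1, e4]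
    exact Bn_rec r w

theorem Bz_rec_zero (u : ℤ) : Bz 0 u = (if u = 0 then 1 else 0) + Bz 1 u := by
  rcases lt_trichotomy u 0 with h | h | h
  · rw [Bz_neg h, Bz_neg h, if_neg (by omega)]
  · subst h
    simp [Bz, Bn_zero, Bn_succ_zero]
  · obtain ⟨w, rfl⟩ : ∃ w : ℕ, u = w + 1 := ⟨(u - 1).toNat, by omega⟩
    have e1 : ((w : ℤ) + 1).toNat = w + 1 := by omega
    have e2 : (0 : ℤ) ≤ (w : ℤ) + 1 := by omega
    have e3 : (w : ℤ) + 1 ≠ 0 := by omega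
    simp [Bz, e1, e2, e3, Bn_rec_zero]

theorem Bz_conv (n r : ℕ) (v : ℤ) (hv : v ≤ n) :
    ∑ p ∈ Finset.HasAntidiagonal.antidiagonal n, catalan p.1 * Bz r (v - p.1 - 1) = Bz (r + 1) v := by
  rcases le_or_gt v 0 with h | h
  · rw [Bz_lt (by omega)]
    apply Finset.sum_eq_zero
    intro p hp
    rw [Bz_neg (by omega), mul_zero]
  · obtain ⟨w, rfl⟩ : ∃ w : ℕ, v = w + 1 := ⟨(v - 1).toNat, by omega⟩
    have e1 : ((w : ℤ) + 1).toNat = w + 1 := by omega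
    have e2 : (0 : ℤ) ≤ (w : ℤ) + 1 := by omega
    rw [Bz, if_pos e2, e1, Bn_conv, Finset.Nat.sum_antidiagonal_eq_sum_range_succ_mk,
      Finset.Nat.sum_antidiagonal_eq_sum_range_succ_mk]
    have hsub : Finset.range (w + 1) ⊆ Finset.range (n + 1) := by
      intro x hx
      simp only [Finset.mem_range] at hx ⊢
      omega
    rw [← Finset.sum_subset hsub]
    · apply Finset.sum_congr rfl
      intro x hx
      simp only [Finset.mem_range] at hx
      simp only
      rw [Bz, if_pos (by omega)]
      congr 2
      omega
    · intro x _ hx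
      simp only [Finset.mem_range] at hx
      simp only
      rw [Bz_neg (by omega), mul_zero]

/-- The formula for the number of marked trees. -/
noncomputable def Ff (R n : ℕ) (u v : ℤ) : ℕ :=
  ∑ r ∈ Finset.range R, cz (n + r - u - v - 1) * (Bz r u * Bz r v)

theorem Ff_term_zero (r n : ℕ) (u v : ℤ) (h : ¬ (0 ≤ u ∧ u < n ∧ 0 ≤ v ∧ v < n)) :
    cz (n + r - u - v - 1) * (Bz r u * Bz r v) = 0 := by
  by_cases h1 : u < r
  · rw [Bz_lt h1]; simp
  by_cases h2 : v < r
  · rw [Bz_lt h2]; simp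
  rw [cz, if_neg (by omega), zero_mul]

theorem sum_trees_succ (n : ℕ) (f : BinaryTree Unit → ℕ) :
    ∑ t ∈ BinaryTree.treesOfNumNodesEq (n + 1), f t =
      ∑ p ∈ Finset.HasAntidiagonal.antidiagonal n, ∑ l ∈ BinaryTree.treesOfNumNodesEq p.1,
        ∑ r ∈ BinaryTree.treesOfNumNodesEq p.2, f (.node () l r) := by
  rw [BinaryTree.treesOfNumNodesEq_succ, Finset.sum_biUnion]
  · apply Finset.sum_congr rfl
    intro p hp
    rw [Finset.sum_map, Finset.sum_product]
    rfl
  · simp_rw [Set.PairwiseDisjoint, Set.Pairwise, Finset.disjoint_left]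
    rintro ⟨a, b⟩ _ ⟨c, d⟩ _ hne t h1 h2
    simp only [Finset.mem_map, Finset.mem_product, BinaryTree.mem_treesOfNumNodesEq,
      Function.Embedding.coeFn_mk, Prod.exists] at h1 h2
    obtain ⟨x, y, ⟨rfl, rfl⟩, rfl⟩ := h1
    obtain ⟨x', y', ⟨rfl, rfl⟩, h⟩ := h2
    have h' : BinaryTree.node () x' y' = BinaryTree.node () x y := h
    rw [BinaryTree.node.injEq] at h'
    replace h := h'.2
    exact hne (by rw [h.1, h.2])

theorem hit_sum : ∀ (n R : ℕ), n ≤ R → ∀ u v : ℤ,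
    ∑ t ∈ BinaryTree.treesOfNumNodesEq n, hit t u v = Ff R n u v := by
  intro n
  induction n using Nat.strong_induction_on with
  | _ n ih =>
  intro R hR u v
  by_cases hr : ¬ (0 ≤ u ∧ u < n ∧ 0 ≤ v ∧ v < n)
  · rw [Ff, Finset.sum_eq_zero, Finset.sum_eq_zero]
    · intro r _
      exact Ff_term_zero r n u v hr
    · intro t ht
      rw [BinaryTree.mem_treesOfNumNodesEq] at ht
      by_contra hne
      have := hit_range t u v hne
      rw [ht] at this
      exact hr this
  push Not at hr
  rcases n with _ | n
  · omega
  obtain ⟨S, rfl⟩ : ∃ S, R = S + 1 := ⟨R - 1, by omega⟩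
  rw [sum_trees_succ]
  have step : ∀ p ∈ Finset.HasAntidiagonal.antidiagonal n, ∑ l ∈ BinaryTree.treesOfNumNodesEq p.1,
        ∑ r ∈ BinaryTree.treesOfNumNodesEq p.2, hit (.node () l r) u v =
      (catalan p.2 * ∑ r ∈ Finset.range S, cz (n + r + 1 - u - v) *
        (Bz r (u - 1) * Bz r (v - p.2 - 1)) +
      catalan p.1 * catalan p.2 * (if u = 0 ∧ v = p.2 then 1 else 0)) +
      catalan p.1 * ∑ r ∈ Finset.range (S + 1), cz (n + r - u - v) *
        (Bz r (u - p.1 - 1) * Bz r v) := by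
    intro p hp
    rw [Finset.HasAntidiagonal.mem_antidiagonal] at hp
    have h1 : ∀ l ∈ BinaryTree.treesOfNumNodesEq p.1, ∀ r ∈ BinaryTree.treesOfNumNodesEq p.2,
        hit (.node () l r) u v = hit l (u - 1) (v - p.2 - 1) +
          (if u = 0 ∧ v = p.2 then 1 else 0) + hit r (u - p.1 - 1) v := by
      intro l hl r hr
      rw [BinaryTree.mem_treesOfNumNodesEq] at hl hr
      rw [hit, hl, hr]
    rw [Finset.sum_congr rfl (fun l hl => Finset.sum_congr rfl (h1 l hl))]
    simp only [Finset.sum_add_distrib, Finset.sum_const, smul_eq_mul,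
      BinaryTree.treesOfNumNodesEq_card_eq_catalan, ← Finset.mul_sum]
    rw [ih p.1 (by omega) S (by omega), ih p.2 (by omega) (S + 1) (by omega), Ff, Ff]
    have ea : ∀ r : ℕ, (p.1 : ℤ) + r - (u - 1) - (v - p.2 - 1) - 1 = n + r + 1 - u - v := by
      intro r; omega
    have eb : ∀ r : ℕ, (p.2 : ℤ) + r - (u - p.1 - 1) - v - 1 = n + r - u - v := by
      intro r; omega
    simp only [ea, eb]
    ring
  rw [Finset.sum_congr rfl step, Finset.sum_add_distrib, Finset.sum_add_distrib]
  have s1 : ∑ p ∈ Finset.HasAntidiagonal.antidiagonal n, catalan p.2 * ∑ r ∈ Finset.range S,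
      cz (n + r + 1 - u - v) * (Bz r (u - 1) * Bz r (v - p.2 - 1)) =
      ∑ r ∈ Finset.range S, cz (n + r + 1 - u - v) * (Bz r (u - 1) * Bz (r + 1) v) := by
    simp only [Finset.mul_sum]
    rw [Finset.sum_comm]
    apply Finset.sum_congr rfl
    intro r _
    rw [← Bz_conv n r v (by omega), ← Finset.Nat.sum_antidiagonal_swap, Finset.mul_sum,
      Finset.mul_sum]
    apply Finset.sum_congr rfl
    intro p _
    simp only [Prod.fst_swap, Prod.snd_swap]
    ring
  have s3 : ∑ p ∈ Finset.HasAntidiagonal.antidiagonal n, catalan p.1 * ∑ r ∈ Finset.range (S + 1),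
      cz (n + r - u - v) * (Bz r (u - p.1 - 1) * Bz r v) =
      ∑ r ∈ Finset.range (S + 1), cz (n + r - u - v) * (Bz (r + 1) u * Bz r v) := by
    simp only [Finset.mul_sum]
    rw [Finset.sum_comm]
    apply Finset.sum_congr rfl
    intro r _
    rw [← Bz_conv n r u (by omega), Finset.sum_mul, Finset.mul_sum]
    apply Finset.sum_congr rfl
    intro p _
    ring
  have s2 : ∑ p ∈ Finset.HasAntidiagonal.antidiagonal n, catalan p.1 * catalan p.2 *
      (if u = 0 ∧ v = p.2 then 1 else 0) =
      cz (n - u - v) * ((if u = 0 then 1 else 0) * Bz 0 v) := by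
    by_cases hu : u = 0
    · subst hu
      obtain ⟨w, rfl⟩ : ∃ w : ℕ, v = w := ⟨v.toNat, by omega⟩
      rw [Finset.sum_eq_single (n - w, w)]
      · simp [Bz, Bn_zero]
        rw [cz, if_pos (by omega)]
        left; congr 1; omega
      · intro p hp hne
        rw [Finset.HasAntidiagonal.mem_antidiagonal] at hp
        rw [if_neg, mul_zero]
        rintro ⟨-, h⟩
        apply hne
        ext <;> simp <;> omega
      · intro h
        exfalso; apply h
        rw [Finset.HasAntidiagonal.mem_antidiagonal]
        simp; omega
    · simp [hu]
  rw [s1, s2, s3, Ff]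
  have ec : ∀ r : ℕ, ((n + 1 : ℕ) : ℤ) + r - u - v - 1 = n + r - u - v := by intro r; omega
  simp only [ec]
  rw [Finset.sum_range_succ', Finset.sum_range_succ' _ S]
  have ed : ∀ r : ℕ, (n : ℤ) + (r + 1 : ℕ) - u - v = n + r + 1 - u - v := by intro r; omega
  simp only [ed]
  have er : ∑ r ∈ Finset.range S, cz (n + r + 1 - u - v) * (Bz (r + 1) u * Bz (r + 1) v) =
      ∑ r ∈ Finset.range S, cz (n + r + 1 - u - v) * (Bz r (u - 1) * Bz (r + 1) v) +
      ∑ r ∈ Finset.range S, cz (n + r + 1 - u - v) * (Bz (r + 1 + 1) u * Bz (r + 1) v) := by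
    rw [← Finset.sum_add_distrib]
    apply Finset.sum_congr rfl
    intro r _
    rw [Bz_rec r u]
    ring
  rw [er, Bz_rec_zero u]
  simp only [Nat.cast_zero, add_zero, zero_add]
  ring

theorem QcountZ_formula (n : ℕ) (j k : ℤ) (u v M : ℕ) (hu : (u : ℤ) = n - k)
    (hv : (v : ℤ) = n - j) (hM : (M : ℤ) = j + k - n - 1) :
    QcountZ n j k = ∑ r ∈ Finset.range n, catalan (M + r) * (Bn r u * Bn r v) := by
  rw [QcountZ_eq, hit_sum n n le_rfl, Ff]
  apply Finset.sum_congr rfl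
  intro r _
  rw [← hu, ← hv, show (n : ℤ) + r - u - v - 1 = ((M + r : ℕ) : ℤ) by push_cast; omega]
  simp [cz, Bz]
  rw [if_pos (by omega)]
  congr 1

theorem Bn_closed (r : ℕ) : ∀ u, r ≤ u → (u + 1) * Bn r u = (r + 1) * (2 * u - r).choose u := by
  induction r using Nat.strong_induction_on with
  | _ r ih =>
  intro u hu
  rcases r with _ | _ | r
  · rw [Bn_zero, succ_mul_catalan_eq_centralBinom]
    simp [Nat.centralBinom]
  · obtain ⟨w, rfl⟩ : ∃ w, u = w + 1 := ⟨u - 1, by omega⟩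
    rw [zero_add, ← Bn_rec_zero, Bn_zero, succ_mul_catalan_eq_centralBinom,
      Nat.centralBinom_eq_two_mul_choose, show 2 * (w + 1) = 2 * w + 1 + 1 by ring,
      Nat.choose_succ_succ, show 2 * w + 1 + 1 - 1 = 2 * w + 1 by omega,
      Nat.choose_symm_half w]
    ring
  · obtain ⟨w, rfl⟩ : ∃ w, u = w + 1 := ⟨u - 1, by omega⟩
    have h1 := ih (r + 1) (by omega) (w + 1) (by omega)
    have h2 := ih r (by omega) w (by omega)
    have h3 := Bn_rec r w
    obtain ⟨d, rfl⟩ : ∃ d, w = r + 1 + d := ⟨w - (r + 1), by omega⟩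
    rw [show 2 * (r + 1 + d + 1) - (r + 1) = r + 2 * d + 2 + 1 by omega] at h1
    rw [show 2 * (r + 1 + d) - r = r + 2 * d + 2 by omega] at h2
    rw [show 2 * (r + 1 + d + 1) - (r + 1 + 1) = r + 2 * d + 2 by omega]
    rw [Nat.choose_succ_succ] at h1
    have h4 := Nat.choose_succ_right_eq (r + 2 * d + 2) (r + 1 + d)
    rw [show r + 2 * d + 2 - (r + 1 + d) = d + 1 by omega] at h4
    rw [h3] at h1
    generalize (r + 2 * d + 2).choose (r + 1 + d) = x at *
    have h4' : (r + 2 * d + 2).choose (r + 1 + d + 1) * (r + 1 + d + 1) = x * (d + 1) := h4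
    have h1' : (r + 1 + d + 1 + 1) * (Bn r (r + 1 + d) + Bn (r + 2) (r + 1 + d + 1)) =
      (r + 1 + 1) * (x + (r + 2 * d + 2).choose (r + 1 + d + 1)) := h1
    generalize (r + 2 * d + 2).choose (r + 1 + d + 1) = y at *
    clear h1 h4 h3 ih hu
    have : (r + 1 + d + 1) * ((r + 1 + d + 1 + 1) * Bn (r + 2) (r + 1 + d + 1)) =
        (r + 1 + d + 1) * ((r + 1 + 1 + 1) * y) := by
      zify at *
      linear_combination (r + 1 + d + 1 : ℤ) * h1' - (r + 1 + d + 1 + 1 : ℤ) * h2 - h4'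
    exact Nat.eq_of_mul_eq_mul_left (by omega) this

/-- Normalised Catalan numbers. -/
noncomputable def Dc (m : ℕ) : ℝ := (catalan m : ℝ) / 4 ^ m

theorem catalan_pos' (m : ℕ) : 0 < (catalan m : ℝ) := by
  have h := succ_mul_catalan_eq_centralBinom m
  have h2 := Nat.centralBinom_pos m
  rw [← h] at h2
  exact_mod_cast Nat.pos_of_mul_pos_left h2

theorem Dc_pos (m : ℕ) : 0 < Dc m := div_pos (catalan_pos' m) (by positivity)

theorem Dc_succ_le (m : ℕ) : Dc (m + 1) ≤ Dc m := by
  have h1 := succ_mul_catalan_eq_centralBinom m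
  have h2 := succ_mul_catalan_eq_centralBinom (m + 1)
  have h3 := Nat.succ_mul_centralBinom_succ m
  rw [← h1, ← h2] at h3
  have h3' : ((m : ℝ) + 1) * (((m : ℝ) + 1 + 1) * catalan (m + 1)) =
      2 * (2 * m + 1) * (((m : ℝ) + 1) * catalan m) := by exact_mod_cast h3
  have hm : (0 : ℝ) < (m : ℝ) + 1 := by positivity
  have h4 : ((m : ℝ) + 2) * catalan (m + 1) = 2 * (2 * m + 1) * catalan m := by
    apply mul_left_cancel₀ hm.ne'
    linear_combination h3'
  have hc := catalan_pos' m
  have h5 : (catalan (m + 1) : ℝ) ≤ 4 * catalan m := by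
    have : ((m : ℝ) + 2) * catalan (m + 1) ≤ ((m : ℝ) + 2) * (4 * catalan m) := by
      rw [h4]; nlinarith
    exact le_of_mul_le_mul_left this (by positivity)
  unfold Dc
  rw [pow_succ, div_le_div_iff₀ (by positivity) (by positivity)]
  have : (0 : ℝ) < 4 ^ m := by positivity
  nlinarith

theorem Dc_antitone : Antitone Dc := antitone_nat_of_succ_le Dc_succ_le

theorem stirling_ratio (n : ℕ) (hn : n ≠ 0) :
    Stirling.stirlingSeq (2 * n) / Stirling.stirlingSeq n ^ 2 =
      √n * (n.centralBinom : ℝ) / 4 ^ n := by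
  have hn' : (0 : ℝ) < n := by positivity
  have hcb : (n.centralBinom : ℝ) = (2 * n).factorial / ((n.factorial : ℝ) ^ 2) := by
    rw [Nat.centralBinom_eq_two_mul_choose, Nat.cast_choose ℝ (by omega),
      show 2 * n - n = n by omega]
    ring
  rw [hcb]
  unfold Stirling.stirlingSeq
  have h1 : √(2 * ((2 * n : ℕ) : ℝ)) = 2 * √n := by
    push_cast
    rw [show (2 : ℝ) * (2 * n) = 2 ^ 2 * n by ring, Real.sqrt_mul (by positivity),
      Real.sqrt_sq (by norm_num)]
  have h2 : (((2 * n : ℕ) : ℝ) / rexp 1) ^ (2 * n) = 4 ^ n * (((n : ℝ) / rexp 1) ^ n) ^ 2 := by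
    push_cast
    rw [mul_div_assoc, mul_pow, pow_mul, ← pow_mul _ n 2, mul_comm n 2]
    norm_num
  rw [h1, h2, div_pow (n.factorial : ℝ), mul_pow (√(2 * (n : ℝ))), Real.sq_sqrt (by positivity)]
  have h3 : (0 : ℝ) < ((n : ℝ) / rexp 1) ^ n := by positivity
  have h4 : (0 : ℝ) < (n.factorial : ℝ) := by positivity
  have h5 : √(n : ℝ) ^ 2 = n := Real.sq_sqrt (by positivity)
  have h6 : (0 : ℝ) < √(n : ℝ) := by positivity
  field_simp
  rw [h5]

theorem Dc_tendsto : Tendsto (fun n : ℕ => (n : ℝ) ^ ((3 : ℝ) / 2) * Dc n) atTop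
    (nhds (1 / √π)) := by
  have h1 := Stirling.tendsto_stirlingSeq_sqrt_pi
  have h2 : Tendsto (fun n : ℕ => 2 * n) atTop atTop :=
    tendsto_id.const_mul_atTop' (by norm_num)
  have hp : (√π) ≠ 0 := by positivity
  have h3 := (h1.comp h2).div (h1.pow 2) (by positivity)
  have h4 : Tendsto (fun n : ℕ => (n : ℝ) / (n + 1)) atTop (nhds 1) := by
    exact_mod_cast tendsto_natCast_div_add_atTop (1 : ℝ)
  have h5 := h3.mul h4
  have e : √π / √π ^ 2 * 1 = 1 / √π := by field_simp
  rw [e] at h5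
  apply h5.congr'
  filter_upwards [eventually_ne_atTop 0] with n hn
  simp only [Function.comp, Pi.div_apply]
  rw [stirling_ratio n hn]
  have hc : (n.centralBinom : ℝ) = (n + 1) * catalan n := by
    exact_mod_cast (succ_mul_catalan_eq_centralBinom n).symm
  have hr : (n : ℝ) ^ ((3 : ℝ) / 2) = √n * n := by
    rw [Real.sqrt_eq_rpow, show (3 : ℝ) / 2 = 1 / 2 + 1 by norm_num,
      Real.rpow_add (by positivity), Real.rpow_one]
  rw [hc, hr, Dc]
  have : (0 : ℝ) < (n : ℝ) + 1 := by positivity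
  field_simp

theorem Dc_scaled (w : ℕ → ℕ) (ω : ℝ) (hω : 0 < ω)
    (hw : Tendsto (fun n : ℕ => (w n : ℝ) / n) atTop (nhds ω)) :
    Tendsto (fun n : ℕ => (n : ℝ) ^ ((3 : ℝ) / 2) * Dc (w n)) atTop
      (nhds (1 / √π / ω ^ ((3 : ℝ) / 2))) := by
  have hwt : Tendsto w atTop atTop := by
    rw [← tendsto_natCast_atTop_iff (R := ℝ)]
    have := hw.pos_mul_atTop hω tendsto_natCast_atTop_atTop
    apply this.congr'
    filter_upwards [eventually_ne_atTop 0] with n hn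
    field_simp
  have h1 := Dc_tendsto.comp hwt
  have h2 : Tendsto (fun n : ℕ => ((w n : ℝ) / n) ^ ((3 : ℝ) / 2)) atTop
      (nhds (ω ^ ((3 : ℝ) / 2))) := hw.rpow_const (Or.inr (by norm_num))
  have h3 := h1.div h2 (by positivity)
  apply h3.congr'
  filter_upwards [eventually_ne_atTop 0, hwt.eventually (eventually_ne_atTop 0)] with n hn hwn
  simp only [Function.comp, Pi.div_apply]
  rw [Real.div_rpow (by positivity) (by positivity)]
  have a1 : (0 : ℝ) < (n : ℝ) ^ ((3 : ℝ) / 2) := by positivity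
  have a2 : (0 : ℝ) < (w n : ℝ) ^ ((3 : ℝ) / 2) := by positivity
  field_simp

/-- Normalised ballot numbers. -/
noncomputable def gg (u r : ℕ) : ℝ := (Bn r u : ℝ) * 2 ^ r / ((r + 1) * catalan u)

theorem gg_nonneg (u r : ℕ) : 0 ≤ gg u r := by unfold gg; positivity

theorem gg_zero (u : ℕ) : gg u 0 = 1 := by
  have := catalan_pos' u
  simp [gg, Bn_zero, this.ne']

theorem Bn_eq (u r : ℕ) : (Bn r u : ℝ) = gg u r * (r + 1) * catalan u / 2 ^ r := by
  have := catalan_pos' u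
  unfold gg
  field_simp

theorem gg_lt {u r : ℕ} (h : u < r) : gg u r = 0 := by simp [gg, Bn_lt h]

theorem gg_succ {u r : ℕ} (h : r < u) : gg u (r + 1) = gg u r * (1 - r / (2 * u - r)) := by
  have h1 := Bn_closed r u h.le
  have h2 := Bn_closed (r + 1) u h
  have h3 := Nat.choose_mul_succ_eq (2 * u - (r + 1)) u
  rw [show 2 * u - (r + 1) + 1 = 2 * u - r by omega, show 2 * u - r - u = u - r by omega] at h3
  have h1' : ((u : ℝ) + 1) * Bn r u = (r + 1) * (2 * u - r).choose u := by exact_mod_cast h1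
  have h2' : ((u : ℝ) + 1) * Bn (r + 1) u = (r + 1 + 1) * (2 * u - (r + 1)).choose u := by
    exact_mod_cast h2
  have h3' : (((2 * u - (r + 1)).choose u : ℕ) : ℝ) * (2 * u - r) =
      ((2 * u - r).choose u : ℕ) * ((u : ℝ) - r) := by
    have e1 : ((2 * u - r : ℕ) : ℝ) = 2 * u - r := by
      rw [Nat.cast_sub (by omega)]; push_cast; ring
    have e2 : ((u - r : ℕ) : ℝ) = (u : ℝ) - r := by rw [Nat.cast_sub h.le]
    rw [← e1, ← e2]
    exact_mod_cast h3
  have hc := catalan_pos' u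
  have hlt : (r : ℝ) < u := by exact_mod_cast h
  have hp : (0 : ℝ) < 2 * u - r := by
    have : (0 : ℝ) ≤ u := by positivity
    linarith
  have b1 : (Bn r u : ℝ) = (r + 1) * (2 * u - r).choose u / (u + 1) := by
    rw [← h1']; field_simp
  have b2 : (Bn (r + 1) u : ℝ) = (r + 1 + 1) * (2 * u - (r + 1)).choose u / (u + 1) := by
    rw [← h2']; field_simp
  unfold gg
  rw [b1, b2, pow_succ]
  push_cast
  have e : 1 - (r : ℝ) / (2 * u - r) = 2 * (u - r) / (2 * u - r) := by
    rw [eq_div_iff hp.ne', sub_mul, div_mul_cancel₀ _ hp.ne']; ring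
  rw [e]
  generalize (2 * (u : ℝ) - r) = q at *
  field_simp
  linear_combination h3'

theorem gg_le (u : ℕ) : ∀ r : ℕ, gg u r ≤ rexp (-(r * (r - 1)) / (4 * u)) := by
  intro r
  induction r with
  | zero => simp [gg_zero]
  | succ r ih =>
    rcases lt_or_ge r u with h | h
    · rw [gg_succ h]
      have hlt : (r : ℝ) < u := by exact_mod_cast h
      have hr0 : (0 : ℝ) ≤ r := by positivity
      have hu : (0 : ℝ) < u := by linarith
      have hp : (0 : ℝ) < 2 * u - r := by linarith
      have h1 : 1 - (r : ℝ) / (2 * u - r) ≤ rexp (-(r / (2 * u))) := by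
        have a1 : (r : ℝ) / (2 * u) ≤ r / (2 * u - r) := by
          apply div_le_div_of_nonneg_left hr0 hp; linarith
        have a2 := Real.add_one_le_exp (-((r : ℝ) / (2 * u)))
        linarith
      have h0 : 0 ≤ 1 - (r : ℝ) / (2 * u - r) := by
        rw [sub_nonneg, div_le_one hp]; linarith
      calc gg u r * (1 - r / (2 * u - r)) ≤
          rexp (-(r * (r - 1)) / (4 * u)) * rexp (-(r / (2 * u))) :=
            mul_le_mul ih h1 h0 (Real.exp_pos _).le
        _ = _ := by
            rw [← Real.exp_add]
            congr 1
            push_cast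
            field_simp
            ring
    · rw [gg_lt (by omega)]
      exact (Real.exp_pos _).le

theorem gg_le_one (u r : ℕ) : gg u r ≤ 1 := by
  refine (gg_le u r).trans ?_
  rw [Real.exp_le_one_iff]
  apply div_nonpos_of_nonpos_of_nonneg _ (by positivity)
  rcases r with _ | r
  · simp
  · push_cast
    have : (0 : ℝ) ≤ r := by positivity
    nlinarith

theorem gg_ge (u K : ℕ) (hK : K < u) : ∀ r : ℕ, r ≤ K →
    rexp (-(r * (r - 1)) / (4 * (u - K))) ≤ gg u r := by
  intro r
  induction r with
  | zero => simp [gg_zero]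
  | succ r ih =>
    intro hr
    rw [gg_succ (by omega)]
    have hKu : (K : ℝ) < u := by exact_mod_cast hK
    have hrK : (r : ℝ) + 1 ≤ K := by exact_mod_cast hr
    have hr0 : (0 : ℝ) ≤ r := by positivity
    have hp : (0 : ℝ) < 2 * u - r := by linarith
    have h1 : rexp (-(r / (2 * (u - K)))) ≤ 1 - (r : ℝ) / (2 * u - r) := by
      have a0 : (0 : ℝ) < 2 * (u - r) := by linarith
      have a1 : (r : ℝ) / (2 * (u - r)) ≤ r / (2 * (u - K)) := by
        apply div_le_div_of_nonneg_left hr0 (by linarith); linarith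
      have a2 := Real.add_one_le_exp ((r : ℝ) / (2 * (u - r)))
      have a3 : 1 - (r : ℝ) / (2 * u - r) = ((r : ℝ) / (2 * (u - r)) + 1)⁻¹ := by
        have : (2 : ℝ) * u - r ≠ 0 := hp.ne'
        have h' : (u : ℝ) - r ≠ 0 := by intro h; rw [h] at a0; simp at a0
        have h'' : (r : ℝ) / (2 * (u - r)) + 1 = (2 * u - r) / (2 * (u - r)) := by
          field_simp; ring
        rw [h'', inv_div]
        field_simp
        ring
      rw [a3]
      calc rexp (-(r / (2 * (u - K)))) ≤ rexp (-(r / (2 * (u - r)))) := by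
            rw [Real.exp_le_exp]; linarith
        _ = (rexp (r / (2 * (u - r))))⁻¹ := Real.exp_neg _
        _ ≤ _ := inv_anti₀ (by positivity) a2
    calc rexp (-(((r + 1 : ℕ) : ℝ) * (((r + 1 : ℕ) : ℝ) - 1)) / (4 * (u - K))) =
          rexp (-(r * (r - 1)) / (4 * (u - K))) * rexp (-(r / (2 * (u - K)))) := by
            rw [← Real.exp_add]
            congr 1
            push_cast
            have : (u : ℝ) - K ≠ 0 := by linarith
            field_simp
            ring
      _ ≤ _ := mul_le_mul (ih (by omega)) h1 (Real.exp_pos _).le (gg_nonneg _ _)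

theorem inv_sqrt_tendsto : Tendsto (fun n : ℕ => 1 / √(n : ℝ)) atTop (nhds 0) := by
  simp only [one_div]
  exact tendsto_inv_atTop_zero.comp (Real.tendsto_sqrt_atTop.comp tendsto_natCast_atTop_atTop)

theorem floor_tendsto (x : ℝ) (hx : 0 ≤ x) :
    Tendsto (fun n : ℕ => (⌊x * √(n : ℝ)⌋₊ : ℝ) / √(n : ℝ)) atTop (nhds x) :=
  (tendsto_nat_floor_mul_div_atTop hx).comp
    (Real.tendsto_sqrt_atTop.comp tendsto_natCast_atTop_atTop)

theorem floor_div_tendsto (x : ℝ) (hx : 0 ≤ x) :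
    Tendsto (fun n : ℕ => (⌊x * √(n : ℝ)⌋₊ : ℝ) / n) atTop (nhds 0) := by
  have := (floor_tendsto x hx).mul inv_sqrt_tendsto
  rw [mul_zero] at this
  apply this.congr'
  filter_upwards [eventually_ne_atTop 0] with n hn
  have h1 : √(n : ℝ) * √(n : ℝ) = n := Real.mul_self_sqrt (by positivity)
  rw [div_mul_div_comm, h1, mul_one]

theorem gg_tendsto (u : ℕ → ℕ) (β : ℝ) (hβ : 0 < β)
    (hu : Tendsto (fun n : ℕ => (u n : ℝ) / n) atTop (nhds β)) (x : ℝ) (hx : 0 ≤ x) :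
    Tendsto (fun n : ℕ => gg (u n) ⌊x * √(n : ℝ)⌋₊) atTop (nhds (rexp (-x ^ 2 / (4 * β)))) := by
  have hf := floor_tendsto x hx
  have hf0 := floor_div_tendsto x hx
  have hnum := (hf.mul (hf.sub inv_sqrt_tendsto)).neg
  have hup := hnum.div (hu.const_mul 4) (by positivity)
  have hlo := hnum.div ((hu.sub hf0).const_mul 4) (by simp; positivity)
  have e1 : -(x * (x - 0)) / (4 * β) = -x ^ 2 / (4 * β) := by ring
  have e2 : -(x * (x - 0)) / (4 * (β - 0)) = -x ^ 2 / (4 * β) := by ring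
  rw [e1] at hup
  rw [e2] at hlo
  have hup' := (Real.continuous_exp.tendsto _).comp hup
  have hlo' := (Real.continuous_exp.tendsto _).comp hlo
  have hlt : ∀ᶠ n : ℕ in atTop, (⌊x * √(n : ℝ)⌋₊ : ℝ) / n < (u n : ℝ) / n :=
    hf0.eventually_lt hu hβ
  refine tendsto_of_tendsto_of_tendsto_of_le_of_le' hlo' hup' ?_ ?_
  · filter_upwards [eventually_ne_atTop 0, hlt] with n hn hl
    have hn' : (0 : ℝ) < n := by positivity
    have hl' : ⌊x * √(n : ℝ)⌋₊ < u n := by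
      rw [div_lt_div_iff_of_pos_right hn'] at hl
      exact_mod_cast hl
    refine le_trans (le_of_eq ?_) (gg_ge (u n) _ hl' _ le_rfl)
    simp only [Function.comp, Pi.div_apply]
    congr 1
    have h1 : √(n : ℝ) * √(n : ℝ) = n := Real.mul_self_sqrt (by positivity)
    rw [← sub_div, ← sub_div, div_mul_div_comm, h1, ← mul_div_assoc, ← neg_div,
      div_div_div_cancel_right₀ hn'.ne']
  · filter_upwards [eventually_ne_atTop 0] with n hn
    have hn' : (0 : ℝ) < n := by positivity
    refine le_trans (gg_le (u n) _) (le_of_eq ?_)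
    simp only [Function.comp, Pi.div_apply]
    congr 1
    have h1 : √(n : ℝ) * √(n : ℝ) = n := Real.mul_self_sqrt (by positivity)
    rw [← sub_div, div_mul_div_comm, h1, ← mul_div_assoc, ← neg_div,
      div_div_div_cancel_right₀ hn'.ne']

theorem sum_eq_integral (h : ℕ → ℝ) (N : ℕ) (hN : ∀ r, N ≤ r → h r = 0) (s : ℝ) (hs : 0 < s) :
    ∫ x in Set.Ioi (0 : ℝ), s * h ⌊x * s⌋₊ = ∑ r ∈ Finset.range N, h r := by
  rw [← MeasureTheory.integral_Ici_eq_integral_Ioi]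
  have hc : Set.EqOn (fun x : ℝ => s * h ⌊x * s⌋₊) (fun x => ∑ r ∈ Finset.range N,
      (Set.Ico ((r : ℝ) / s) ((r + 1) / s)).indicator (fun _ => s * h r) x) (Set.Ici 0) := by
    intro x hx
    have hx0 : 0 ≤ x * s := mul_nonneg hx hs.le
    have hm : ∀ r : ℕ, x ∈ Set.Ico ((r : ℝ) / s) ((r + 1) / s) ↔ r = ⌊x * s⌋₊ := by
      intro r
      rw [Set.mem_Ico, div_le_iff₀ hs, lt_div_iff₀ hs, eq_comm, Nat.floor_eq_iff hx0]
    simp only [Set.indicator_apply, hm]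
    rw [Finset.sum_ite_eq' (Finset.range N)]
    split_ifs with hr
    · rfl
    · rw [hN _ (by simpa using hr), mul_zero]
  rw [MeasureTheory.setIntegral_congr_fun measurableSet_Ici hc, MeasureTheory.integral_finsetSum]
  · apply Finset.sum_congr rfl
    intro r _
    have hsub : Set.Ico ((r : ℝ) / s) ((r + 1) / s) ⊆ Set.Ici 0 := by
      intro x hx
      exact le_trans (by positivity) hx.1
    rw [MeasureTheory.setIntegral_indicator measurableSet_Ico, Set.inter_eq_right.2 hsub,
      MeasureTheory.setIntegral_const, Real.volume_real_Ico_of_le (by gcongr; linarith)]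
    simp only [smul_eq_mul]
    field_simp
    ring
  · intro r _
    apply MeasureTheory.Integrable.integrableOn
    rw [MeasureTheory.integrable_indicator_iff measurableSet_Ico]
    exact MeasureTheory.integrableOn_const (by simp)

theorem gauss_int (p : ℝ) (hp : 0 < p) :
    ∫ x in Set.Ioi (0 : ℝ), x ^ 2 * rexp (-p * x ^ 2) = √π / 4 / p ^ ((3 : ℝ) / 2) := by
  have h := integral_rpow_mul_exp_neg_mul_rpow (p := 2) (q := 2) (b := p) (by norm_num)
    (by norm_num) hp
  simp only [Real.rpow_two] at h
  rw [h, show (-((2 : ℝ) + 1) / 2) = -(3 / 2) by norm_num, Real.rpow_neg hp.le,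
    show ((2 : ℝ) + 1) / 2 = ((1 : ℕ) : ℝ) + 1 / 2 by norm_num, Real.Gamma_nat_add_half]
  have : 0 < p ^ ((3 : ℝ) / 2) := by positivity
  simp
  field_simp
  norm_num

/-- The dominating function estimate. -/
theorem dom_bound (n u r : ℕ) (hn : 1 ≤ n) (hu0 : 0 < u) (hu : u ≤ n) (x : ℝ) (hx : 0 ≤ x)
    (hr : r = ⌊x * √(n : ℝ)⌋₊) :
    ((r : ℝ) + 1) ^ 2 / n * gg u r ≤ 2 * rexp 8 * rexp (-x) := by
  have hn1 : (1 : ℝ) ≤ n := by exact_mod_cast hn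
  have hs1 : 1 ≤ √(n : ℝ) := by rw [Real.one_le_sqrt]; exact hn1
  have hsq : √(n : ℝ) * √(n : ℝ) = n := Real.mul_self_sqrt (by positivity)
  set s := √(n : ℝ) with hs
  have hxs : 0 ≤ x * s := by positivity
  obtain ⟨hr1, hr2⟩ := (Nat.floor_eq_iff hxs).1 hr.symm
  have hr0 : (0 : ℝ) ≤ r := by positivity
  have a1 : ((r : ℝ) + 1) ^ 2 / n ≤ (x + 1) ^ 2 := by
    rw [div_le_iff₀ (by positivity), ← hsq]
    have : (r : ℝ) + 1 ≤ (x + 1) * s := by nlinarith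
    calc ((r : ℝ) + 1) ^ 2 ≤ ((x + 1) * s) ^ 2 := by gcongr
      _ = _ := by ring
  have a2 : (x + 1) ^ 2 ≤ 2 * rexp x := by
    have := Real.quadratic_le_exp_of_nonneg hx
    nlinarith
  have hun : (u : ℝ) ≤ n := by exact_mod_cast hu
  have hu0' : (0 : ℝ) < u := by exact_mod_cast hu0
  have hrr : (0 : ℝ) ≤ r * (r - 1) := by
    rcases r with _ | r
    · simp
    · push_cast; simp; positivity
  have a3 : gg u r ≤ rexp (8 - 2 * x) := by
    refine (gg_le u r).trans ?_
    rw [Real.exp_le_exp]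
    have b1 : -((r : ℝ) * (r - 1)) / (4 * u) ≤ -((r : ℝ) * (r - 1)) / (4 * n) := by
      rw [neg_div, neg_div, neg_le_neg_iff]
      exact div_le_div_of_nonneg_left hrr (by positivity) (by linarith)
    refine b1.trans ?_
    rw [div_le_iff₀ (by positivity)]
    have b2 : (x * s) ^ 2 - 3 * (x * s) ≤ (r : ℝ) * (r - 1) := by
      nlinarith [mul_nonneg (sub_nonneg.2 hr1) hr0, mul_nonneg (sub_nonneg.2 hr1) (sub_nonneg.2 hr2.le)]
    have b3 : x * s ≤ x * n := by
      rw [← hsq]; nlinarith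
    have b4 : (x * s) ^ 2 = x ^ 2 * n := by rw [← hsq]; ring
    have b5 : 0 ≤ (n : ℝ) * (x - 11 / 2) ^ 2 := by positivity
    nlinarith
  calc ((r : ℝ) + 1) ^ 2 / n * gg u r ≤ (2 * rexp x) * rexp (8 - 2 * x) :=
        mul_le_mul (a1.trans a2) a3 (gg_nonneg _ _) (by positivity)
    _ = _ := by
        rw [mul_assoc, mul_assoc, ← Real.exp_add, ← Real.exp_add]
        ring_nf

/-- The summand, normalised. -/
noncomputable def Tt (n M u v r : ℕ) : ℝ :=
  (n : ℝ) ^ ((3 : ℝ) / 2) * (catalan (M + r) * (Bn r u * Bn r v) : ℝ) / catalan n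

theorem Tt_eq (n M u v r : ℕ) (hn : n ≠ 0) (h : M + u + v + 1 = n) :
    √(n : ℝ) * Tt n M u v r = 1 / 4 * ((n : ℝ) ^ ((3 : ℝ) / 2) * Dc (M + r)) *
      ((n : ℝ) ^ ((3 : ℝ) / 2) * Dc u) * ((n : ℝ) ^ ((3 : ℝ) / 2) * Dc v) /
      ((n : ℝ) ^ ((3 : ℝ) / 2) * Dc n) * (((r : ℝ) + 1) ^ 2 / n * gg u r) * gg v r := by
  have hn' : (0 : ℝ) < n := by positivity
  have hr : (n : ℝ) ^ ((3 : ℝ) / 2) = √n * n := by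
    rw [Real.sqrt_eq_rpow, show (3 : ℝ) / 2 = 1 / 2 + 1 by norm_num,
      Real.rpow_add (by positivity), Real.rpow_one]
  have h1 : √(n : ℝ) * √(n : ℝ) = n := Real.mul_self_sqrt (by positivity)
  have hs : 0 < √(n : ℝ) := by positivity
  have h4 : (4 : ℝ) ^ r = 2 ^ r * 2 ^ r := by rw [← mul_pow]; norm_num
  have hp : (4 : ℝ) ^ n = 4 ^ M * 4 ^ u * 4 ^ v * 4 := by
    rw [← h]; ring
  unfold Tt Dc
  rw [Bn_eq u r, Bn_eq v r, hr, pow_add, h4, hp]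
  have c1 := catalan_pos' n
  field_simp

theorem main_sum (u v M : ℕ → ℕ) (β γ μ : ℝ) (hβ : 0 < β) (hγ : 0 < γ) (hμ : 0 < μ)
    (hsum : ∀ᶠ n : ℕ in atTop, M n + u n + v n + 1 = n)
    (hu : Tendsto (fun n : ℕ => (u n : ℝ) / n) atTop (nhds β))
    (hv : Tendsto (fun n : ℕ => (v n : ℝ) / n) atTop (nhds γ))
    (hM : Tendsto (fun n : ℕ => (M n : ℝ) / n) atTop (nhds μ)) :
    Tendsto (fun n : ℕ => ∑ r ∈ Finset.range n, Tt n (M n) (u n) (v n) r) atTop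
      (nhds (1 / (2 * √π * (β + γ) ^ ((3 : ℝ) / 2) * μ ^ ((3 : ℝ) / 2)))) := by
  have hDn : Tendsto (fun n : ℕ => (n : ℝ) ^ ((3 : ℝ) / 2) * Dc n) atTop (nhds (1 / √π)) :=
    Dc_tendsto
  have hDu := Dc_scaled u β hβ hu
  have hDv := Dc_scaled v γ hγ hv
  have hDM := Dc_scaled M μ hμ hM
  have hpi : 0 < √π := by positivity
  set A : ℝ := 1 / 4 * (1 / √π / μ ^ ((3 : ℝ) / 2)) * (1 / √π / β ^ ((3 : ℝ) / 2)) *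
    (1 / √π / γ ^ ((3 : ℝ) / 2)) / (1 / √π) with hA
  have hcoef : Tendsto (fun n : ℕ => 1 / 4 * ((n : ℝ) ^ ((3 : ℝ) / 2) * Dc (M n)) *
      ((n : ℝ) ^ ((3 : ℝ) / 2) * Dc (u n)) * ((n : ℝ) ^ ((3 : ℝ) / 2) * Dc (v n)) /
      ((n : ℝ) ^ ((3 : ℝ) / 2) * Dc n)) atTop (nhds A) :=
    (((hDM.const_mul (1 / 4)).mul hDu).mul hDv).div hDn (by positivity)
  have hupos : ∀ᶠ n : ℕ in atTop, 0 < u n := by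
    filter_upwards [hu.eventually_const_lt hβ] with n hn
    rcases Nat.eq_zero_or_pos (u n) with h | h
    · simp [h] at hn
    · exact h
  set p : ℝ := 1 / (4 * β) + 1 / (4 * γ) with hp
  have hp0 : 0 < p := by positivity
  have hlim : Tendsto (fun n : ℕ => ∫ x in Set.Ioi (0 : ℝ),
      √(n : ℝ) * Tt n (M n) (u n) (v n) ⌊x * √(n : ℝ)⌋₊) atTop
      (nhds (∫ x in Set.Ioi (0 : ℝ), A * (x ^ 2 * rexp (-p * x ^ 2)))) := by
    apply MeasureTheory.tendsto_integral_filter_of_dominated_convergence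
      (fun x => (A + 1) * (2 * rexp 8 * rexp (-x)))
    · apply Eventually.of_forall
      intro n
      apply Measurable.aestronglyMeasurable
      apply Measurable.const_mul
      exact (measurable_from_nat (f := fun r => Tt n (M n) (u n) (v n) r)).comp
        (Nat.measurable_floor.comp (measurable_id.mul_const _))
    · filter_upwards [eventually_ne_atTop 0, hsum, hupos,
        hcoef.eventually_lt_const (lt_add_one A)] with n hn hs hup hc
      rw [MeasureTheory.ae_restrict_iff' measurableSet_Ioi]
      apply Eventually.of_forall
      intro x hx
      have hx0 : (0 : ℝ) ≤ x := le_of_lt hx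
      have hn0 : 0 < (n : ℝ) ^ ((3 : ℝ) / 2) := by positivity
      have d1 := Dc_pos (u n)
      have d2 := Dc_pos (v n)
      have d3 := Dc_pos n
      have d4 := Dc_pos (M n + ⌊x * √(n : ℝ)⌋₊)
      have g1 := gg_nonneg (u n) ⌊x * √(n : ℝ)⌋₊
      have g2 := gg_nonneg (v n) ⌊x * √(n : ℝ)⌋₊
      rw [Tt_eq _ _ _ _ _ hn hs, Real.norm_of_nonneg (by positivity)]
      have b1 := dom_bound n (u n) _ (by omega) hup (by omega) x hx0 rfl
      have b2 := gg_le_one (v n) ⌊x * √(n : ℝ)⌋₊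
      have b3 : 1 / 4 * ((n : ℝ) ^ ((3 : ℝ) / 2) * Dc (M n + ⌊x * √(n : ℝ)⌋₊)) *
          ((n : ℝ) ^ ((3 : ℝ) / 2) * Dc (u n)) * ((n : ℝ) ^ ((3 : ℝ) / 2) * Dc (v n)) /
          ((n : ℝ) ^ ((3 : ℝ) / 2) * Dc n) ≤ A + 1 := by
        refine le_trans ?_ hc.le
        have := Dc_antitone (Nat.le_add_right (M n) ⌊x * √(n : ℝ)⌋₊)
        gcongr
      have hA1 : 0 ≤ A + 1 := by positivity
      calc _ ≤ (A + 1) * (2 * rexp 8 * rexp (-x)) * 1 := by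
            apply mul_le_mul _ b2 g2 (by positivity)
            exact mul_le_mul b3 b1 (by positivity) hA1
        _ = _ := mul_one _
    · exact ((integrableOn_exp_neg_Ioi 0).const_mul _).const_mul _
    · rw [MeasureTheory.ae_restrict_iff' measurableSet_Ioi]
      apply Eventually.of_forall
      intro x hx
      have hx0 : (0 : ℝ) ≤ x := le_of_lt hx
      have hMr : Tendsto (fun n : ℕ => ((M n + ⌊x * √(n : ℝ)⌋₊ : ℕ) : ℝ) / n) atTop (nhds μ) := by
        have := hM.add (floor_div_tendsto x hx0)
        rw [add_zero] at this
        refine this.congr (fun n => ?_)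
        push_cast
        rw [add_div]
      have hDMr := Dc_scaled _ μ hμ hMr
      have hr2 : Tendsto (fun n : ℕ => ((⌊x * √(n : ℝ)⌋₊ : ℝ) + 1) ^ 2 / n) atTop
          (nhds (x ^ 2)) := by
        have := ((floor_tendsto x hx0).add inv_sqrt_tendsto).pow 2
        rw [add_zero] at this
        refine this.congr (fun n => ?_)
        rw [← add_div, div_pow, Real.sq_sqrt (by positivity)]
      have hall := (((((hDMr.const_mul (1 / 4)).mul hDu).mul hDv).div hDn (by positivity)).mul
        (hr2.mul (gg_tendsto u β hβ hu x hx0))).mul (gg_tendsto v γ hγ hv x hx0)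
      have e : 1 / 4 * (1 / √π / μ ^ ((3 : ℝ) / 2)) * (1 / √π / β ^ ((3 : ℝ) / 2)) *
          (1 / √π / γ ^ ((3 : ℝ) / 2)) / (1 / √π) * (x ^ 2 * rexp (-x ^ 2 / (4 * β))) *
          rexp (-x ^ 2 / (4 * γ)) = A * (x ^ 2 * rexp (-p * x ^ 2)) := by
        rw [← hA, mul_assoc, mul_assoc, ← Real.exp_add]
        congr 3
        rw [hp]; ring
      rw [e] at hall
      apply hall.congr'
      filter_upwards [eventually_ne_atTop 0, hsum] with n hn hs
      rw [Tt_eq _ _ _ _ _ hn hs]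
      rfl
  have hval : ∫ x in Set.Ioi (0 : ℝ), A * (x ^ 2 * rexp (-p * x ^ 2)) =
      1 / (2 * √π * (β + γ) ^ ((3 : ℝ) / 2) * μ ^ ((3 : ℝ) / 2)) := by
    rw [MeasureTheory.integral_const_mul, gauss_int p hp0]
    have hp' : p = (β + γ) / (4 * (β * γ)) := by rw [hp]; field_simp; ring
    have h8 : (4 : ℝ) ^ ((3 : ℝ) / 2) = 8 := by
      rw [show (4 : ℝ) = 2 ^ (2 : ℝ) by norm_num, ← Real.rpow_mul (by norm_num)]
      norm_num
    rw [hp', Real.div_rpow (by positivity) (by positivity),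
      Real.mul_rpow (by norm_num) (by positivity), Real.mul_rpow hβ.le hγ.le, h8, hA]
    have q1 : 0 < β ^ ((3 : ℝ) / 2) := by positivity
    have q2 : 0 < γ ^ ((3 : ℝ) / 2) := by positivity
    have q3 : 0 < μ ^ ((3 : ℝ) / 2) := by positivity
    have q4 : 0 < (β + γ) ^ ((3 : ℝ) / 2) := by positivity
    generalize β ^ ((3 : ℝ) / 2) = b1 at *
    generalize γ ^ ((3 : ℝ) / 2) = b2 at *
    generalize μ ^ ((3 : ℝ) / 2) = b3 at *
    generalize (β + γ) ^ ((3 : ℝ) / 2) = b4 at *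
    field_simp
    norm_num
  rw [hval] at hlim
  apply hlim.congr'
  filter_upwards [eventually_ne_atTop 0, hsum] with n hn hs
  apply sum_eq_integral (fun r => Tt n (M n) (u n) (v n) r) n
  · intro r hr
    simp [Tt, Bn_lt (show u n < r by omega)]
  · positivity

theorem floor_lin_tendsto (b c α : ℝ) (hα1 : α < 1) :
    Tendsto (fun n : ℕ => (⌊b * n - c * (n : ℝ) ^ α⌋ : ℝ) / n) atTop (nhds b) := by
  have h1 : Tendsto (fun n : ℕ => (n : ℝ) ^ (-(1 - α))) atTop (nhds 0) :=
    (tendsto_rpow_neg_atTop (by linarith)).comp tendsto_natCast_atTop_atTop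
  have h2 : Tendsto (fun n : ℕ => 1 / (n : ℝ)) atTop (nhds 0) := tendsto_one_div_atTop_nhds_zero_nat
  have h3 : Tendsto (fun n : ℕ => b - c * (n : ℝ) ^ (-(1 - α))) atTop (nhds b) := by
    have := (h1.const_mul c).const_sub b
    simpa using this
  have h4 : Tendsto (fun n : ℕ => b - c * (n : ℝ) ^ (-(1 - α)) - 1 / (n : ℝ)) atTop (nhds b) := by
    have := h3.sub h2
    simpa using this
  have hid : ∀ n : ℕ, n ≠ 0 → (b * n - c * (n : ℝ) ^ α) / n = b - c * (n : ℝ) ^ (-(1 - α)) := by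
    intro n hn
    have hn' : (0 : ℝ) < n := by positivity
    rw [show -(1 - α) = α - 1 by ring, Real.rpow_sub_one hn'.ne']
    field_simp
  refine tendsto_of_tendsto_of_tendsto_of_le_of_le' h4 h3 ?_ ?_
  · filter_upwards [eventually_ne_atTop 0] with n hn
    rw [← hid n hn, ← sub_div]
    gcongr
    exact (Int.sub_one_lt_floor _).le
  · filter_upwards [eventually_ne_atTop 0] with n hn
    rw [← hid n hn]
    gcongr
    exact Int.floor_le _

/-- Below the anti-diagonal (`a + b > 1`),
`n^{3/2} Q_n(⌊an - cn^α⌋, ⌊bn - cn^α⌋)/C_n → 1/(2√π (2-a-b)^{3/2} (a+b-1)^{3/2})`. -/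
theorem Qcount_below_antidiagonal_limit (a b : ℝ) (ha0 : 0 < a) (ha1 : a < 1)
    (hb0 : 0 < b) (hb1 : b < 1) (hab : 1 < a + b) (c : ℝ) (α : ℝ)
    (hα0 : 0 < α) (hα1 : α < 1) :
    Tendsto (fun n : ℕ =>
        (n : ℝ) ^ ((3 : ℝ) / 2) *
          (QcountZ n ⌊a * n - c * (n : ℝ) ^ α⌋ ⌊b * n - c * (n : ℝ) ^ α⌋ : ℝ) /
          (catalan n : ℝ))
      atTop
      (nhds (1 / (2 * Real.sqrt π * (2 - a - b) ^ ((3 : ℝ) / 2) *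
        (a + b - 1) ^ ((3 : ℝ) / 2)))) := by
  set j : ℕ → ℤ := fun n => ⌊a * n - c * (n : ℝ) ^ α⌋ with hj
  set k : ℕ → ℤ := fun n => ⌊b * n - c * (n : ℝ) ^ α⌋ with hk
  have hjl : Tendsto (fun n : ℕ => (j n : ℝ) / n) atTop (nhds a) := floor_lin_tendsto a c α hα1
  have hkl : Tendsto (fun n : ℕ => (k n : ℝ) / n) atTop (nhds b) := floor_lin_tendsto b c α hα1
  have h0 : Tendsto (fun n : ℕ => 1 / (n : ℝ)) atTop (nhds 0) := tendsto_one_div_atTop_nhds_zero_nat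
  have key : ∀ (z : ℕ → ℤ) (ω : ℝ), 0 < ω →
      Tendsto (fun n : ℕ => (z n : ℝ) / n) atTop (nhds ω) →
      (∀ᶠ n : ℕ in atTop, 0 ≤ z n) ∧
      Tendsto (fun n : ℕ => (((z n).toNat : ℕ) : ℝ) / n) atTop (nhds ω) := by
    intro z ω hω hz
    have hpos : ∀ᶠ n : ℕ in atTop, 0 ≤ z n := by
      filter_upwards [hz.eventually_const_lt hω, eventually_ne_atTop 0] with n hn hn0
      have hn' : (0 : ℝ) < n := by positivity
      rw [div_pos_iff_of_pos_right hn'] at hn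
      exact_mod_cast hn.le
    refine ⟨hpos, hz.congr' ?_⟩
    filter_upwards [hpos] with n hn
    have : (((z n).toNat : ℤ) : ℝ) = (z n : ℝ) := by rw [Int.toNat_of_nonneg hn]
    rw [← this, Int.cast_natCast]
  have hul : Tendsto (fun n : ℕ => (((n : ℤ) - k n : ℤ) : ℝ) / n) atTop (nhds (1 - b)) := by
    refine (hkl.const_sub 1).congr' ?_
    filter_upwards [eventually_ne_atTop 0] with n hn
    push_cast
    field_simp
  have hvl : Tendsto (fun n : ℕ => (((n : ℤ) - j n : ℤ) : ℝ) / n) atTop (nhds (1 - a)) := by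
    refine (hjl.const_sub 1).congr' ?_
    filter_upwards [eventually_ne_atTop 0] with n hn
    push_cast
    field_simp
  have hMl : Tendsto (fun n : ℕ => ((j n + k n - n - 1 : ℤ) : ℝ) / n) atTop
      (nhds (a + b - 1)) := by
    have := ((hjl.add hkl).sub_const 1).sub h0
    rw [sub_zero] at this
    refine this.congr' ?_
    filter_upwards [eventually_ne_atTop 0] with n hn
    push_cast
    field_simp
  obtain ⟨u1, u2⟩ := key _ _ (by linarith) hul
  obtain ⟨v1, v2⟩ := key _ _ (by linarith) hvl
  obtain ⟨M1, M2⟩ := key _ _ (by linarith) hMl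
  have hfin := main_sum _ _ _ _ _ _ (by linarith) (by linarith) (by linarith)
    (by filter_upwards [u1, v1, M1] with n h1 h2 h3; omega) u2 v2 M2
  rw [show (1 - b) + (1 - a) = 2 - a - b by ring] at hfin
  apply hfin.congr'
  filter_upwards [u1, v1, M1] with n h1 h2 h3
  have hq := QcountZ_formula n (j n) (k n) ((n : ℤ) - k n).toNat ((n : ℤ) - j n).toNat
    (j n + k n - n - 1).toNat (Int.toNat_of_nonneg h1) (Int.toNat_of_nonneg h2)
    (Int.toNat_of_nonneg h3)
  rw [hq]
  unfold Tt
  push_cast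
  rw [Finset.mul_sum, Finset.sum_div]
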